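/- Let f : (0,∞)ⁿ → ℝ be measurable, nonnegative, positively homogeneous of degree t > -(n+1), and integrable on the canonical simplex. Then the function h_f(z) := Γ(1+n+t) ∫_{{x ∈ ℝⁿ₊ : zᵀx ≤ 1}} f(x) dx, defined for z in the open positive orthant, equals the multidimensional Laplace transform of f, i.e., h_f(z) = ∫_{ℝⁿ₊} f(x) e^{-zᵀx} dx, and in particular h_f is completely monotone on the open positive orthant. -/

import Mathlib

open MeasureTheory Finset

theorem exists_pos_forall_le {ι : Type*} [Finite ι] {z : ι → ℝ} (hz : ∀ i, 0 < z i) :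
    ∃ c : ℝ, 0 < c ∧ ∀ i, c ≤ z i := by
  cases isEmpty_or_nonempty ι
  · exact ⟨1, one_pos, fun i => isEmptyElim i⟩
  · obtain ⟨i, hi⟩ := Finite.exists_min z
    exact ⟨z i, hz i, hi⟩

theorem isOpen_setOf_forall_pos {ι : Type*} [Finite ι] :
    IsOpen {z : ι → ℝ | ∀ i, 0 < z i} := by
  simpa only [Set.ofPred_forall] using
    isOpen_iInter_of_finite fun i => isOpen_lt continuous_const (continuous_apply i)

section Laplace

variable {ι : Type*} [Fintype ι] {μ : Measure (ι → ℝ)} {g : (ι → ℝ) → ℝ}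

/-- The multidimensional Laplace transform of `g` with respect to the measure `μ`. -/
noncomputable def laplaceTransform (μ : Measure (ι → ℝ)) (g : (ι → ℝ) → ℝ) (z : ι → ℝ) : ℝ :=
  ∫ x, g x * Real.exp (-∑ i, z i * x i) ∂μ

/-- The function `g` has a convergent Laplace transform on the open positive orthant. -/
def LaplaceIntegrable (μ : Measure (ι → ℝ)) (g : (ι → ℝ) → ℝ) : Prop :=
  ∀ z : ι → ℝ, (∀ i, 0 < z i) → Integrable (fun x => g x * Real.exp (-∑ i, z i * x i)) μ

theorem LaplaceIntegrable.coord_mul (hμ : ∀ᵐ x ∂μ, ∀ i, 0 ≤ x i) (hg : LaplaceIntegrable μ g)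
    (j : ι) : LaplaceIntegrable μ fun x => x j * g x := by
  intro z hz
  have hhalf : Integrable (fun x => g x * Real.exp (-∑ i, z i / 2 * x i)) μ :=
    hg (fun i => z i / 2) fun i => half_pos (hz i)
  have hsplit : ∀ x : ι → ℝ, -∑ i, z i * x i = -(∑ i, z i / 2 * x i) + -∑ i, z i / 2 * x i := by
    intro x
    rw [← neg_add, ← sum_add_distrib]
    congr 1
    exact sum_congr rfl fun i _ => by ring
  have hfun : (fun x => x j * g x * Real.exp (-∑ i, z i * x i)) = fun x =>
      (x j * Real.exp (-∑ i, z i / 2 * x i)) * (g x * Real.exp (-∑ i, z i / 2 * x i)) := by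
    ext x
    rw [hsplit, Real.exp_add]
    ring
  rw [hfun]
  refine hhalf.bdd_mul (c := 2 / z j) (Continuous.aestronglyMeasurable (by fun_prop)) ?_
  filter_upwards [hμ] with x hx
  have hzj := hz j
  have hle : z j / 2 * x j ≤ ∑ i, z i / 2 * x i :=
    single_le_sum (f := fun i => z i / 2 * x i)
      (fun i _ => mul_nonneg (half_pos (hz i)).le (hx i)) (mem_univ j)
  have hexp : z j / 2 * x j ≤ Real.exp (∑ i, z i / 2 * x i) := by
    linarith [Real.add_one_le_exp (∑ i, z i / 2 * x i)]
  rw [Real.norm_of_nonneg (mul_nonneg (hx j) (Real.exp_pos _).le), Real.exp_neg,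
    ← div_eq_mul_inv, div_le_div_iff₀ (Real.exp_pos _) hzj]
  linarith

theorem hasFDerivAt_mul_exp_neg_sum (a : ℝ) (x w : ι → ℝ) :
    HasFDerivAt (fun w : ι → ℝ => a * Real.exp (-∑ i, w i * x i))
      (-∑ i, (x i * a * Real.exp (-∑ i, w i * x i)) •
        (ContinuousLinearMap.proj i : (ι → ℝ) →L[ℝ] ℝ)) w := by
  have hlin : HasFDerivAt (fun w : ι → ℝ => -∑ i, w i * x i)
      (-∑ i, x i • (ContinuousLinearMap.proj i : (ι → ℝ) →L[ℝ] ℝ)) w :=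
    (HasFDerivAt.fun_sum fun i _ => (hasFDerivAt_apply i w).mul_const (x i)).neg
  refine (hlin.exp.const_mul a).congr_fderiv ?_
  ext v
  simp only [smul_neg, smul_sum, smul_smul]
  congr 2
  refine sum_congr rfl fun i _ => ?_
  congr 1
  ring

theorem hasFDerivAt_laplaceTransform (hμ : ∀ᵐ x ∂μ, ∀ i, 0 ≤ x i) (hg : LaplaceIntegrable μ g)
    {z : ι → ℝ} (hz : ∀ i, 0 < z i) :
    HasFDerivAt (laplaceTransform μ g)
      (-∑ i, laplaceTransform μ (fun x => x i * g x) z •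
        (ContinuousLinearMap.proj i : (ι → ℝ) →L[ℝ] ℝ)) z := by
  obtain ⟨c, hc, hcz⟩ := exists_pos_forall_le hz
  obtain ⟨F', hF'⟩ : ∃ F' : (ι → ℝ) → (ι → ℝ) → (ι → ℝ) →L[ℝ] ℝ, ∀ w x, F' w x =
      -∑ i, (x i * g x * Real.exp (-∑ i, w i * x i)) •
        (ContinuousLinearMap.proj i : (ι → ℝ) →L[ℝ] ℝ) := ⟨_, fun _ _ => rfl⟩
  have hint : ∀ i, Integrable (fun x => (x i * g x * Real.exp (-∑ i, z i * x i)) •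
      (ContinuousLinearMap.proj i : (ι → ℝ) →L[ℝ] ℝ)) μ := fun i =>
    (hg.coord_mul hμ i z hz).smul_const _
  have hF'z : F' z = fun x => -∑ i, (x i * g x * Real.exp (-∑ i, z i * x i)) •
        (ContinuousLinearMap.proj i : (ι → ℝ) →L[ℝ] ℝ) := funext (hF' z)
  have hintegral : -∑ i, laplaceTransform μ (fun x => x i * g x) z •
        (ContinuousLinearMap.proj i : (ι → ℝ) →L[ℝ] ℝ) = ∫ x, F' z x ∂μ := by
    rw [hF'z, integral_neg, integral_finsetSum _ fun i _ => hint i]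
    simp only [laplaceTransform, integral_smul_const]
  have hbound : ∀ i, Integrable (fun x => ‖x i * g x * Real.exp (-∑ i, z i / 2 * x i)‖ *
      ‖(ContinuousLinearMap.proj i : (ι → ℝ) →L[ℝ] ℝ)‖) μ := by
    intro i
    have h := hg.coord_mul hμ i (fun i => z i / 2) fun i => half_pos (hz i)
    exact h.norm.mul_const _
  rw [hintegral]
  refine hasFDerivAt_integral_of_dominated_of_fderiv_le (𝕜 := ℝ)
    (Metric.ball_mem_nhds z (half_pos hc)) ?_ (hg z hz) ?_ ?_
    (integrable_finsetSum univ fun i _ => hbound i) ?_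
  · filter_upwards [isOpen_setOf_forall_pos.mem_nhds hz] with w hw
    exact (hg w hw).aestronglyMeasurable
  · rw [hF'z]
    exact (Finset.aestronglyMeasurable_fun_sum univ fun i _ => (hint i).aestronglyMeasurable).neg
  · filter_upwards [hμ] with x hx w hw
    rw [hF', norm_neg]
    refine (norm_sum_le _ _).trans (sum_le_sum fun i _ => ?_)
    rw [norm_smul]
    gcongr ?_ * _
    rw [norm_mul _ (Real.exp _), norm_mul _ (Real.exp _), Real.norm_of_nonneg (Real.exp_pos _).le,
      Real.norm_of_nonneg (Real.exp_pos _).le]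
    gcongr with k
    · exact hx k
    · have h1 : |w k - z k| < c / 2 := by
        simpa [Real.dist_eq] using (dist_le_pi_dist w z k).trans_lt hw
      linarith [(abs_lt.1 h1).1, hcz k]
  · refine Filter.Eventually.of_forall fun x w _ => ?_
    rw [hF']
    exact hasFDerivAt_mul_exp_neg_sum (g x) x w

theorem contDiffOn_laplaceTransform (hμ : ∀ᵐ x ∂μ, ∀ i, 0 ≤ x i) (hg : LaplaceIntegrable μ g)
    (k : ℕ) : ContDiffOn ℝ k (laplaceTransform μ g) {z | ∀ i, 0 < z i} := by
  induction k generalizing g with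
  | zero =>
    exact contDiffOn_zero.2 fun z hz =>
      (hasFDerivAt_laplaceTransform hμ hg hz).continuousAt.continuousWithinAt
  | succ k ih =>
    push_cast
    rw [contDiffOn_succ_iff_fderiv_of_isOpen isOpen_setOf_forall_pos]
    refine ⟨fun z hz =>
      (hasFDerivAt_laplaceTransform hμ hg hz).differentiableAt.differentiableWithinAt,
      by simp, ?_⟩
    refine ContDiffOn.congr ?_ fun z hz => (hasFDerivAt_laplaceTransform hμ hg hz).fderiv
    exact (ContDiffOn.sum fun i _ => (ih (hg.coord_mul hμ i)).smul contDiffOn_const).neg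

theorem iteratedFDerivWithin_laplaceTransform_nonneg [DecidableEq ι]
    (hμ : ∀ᵐ x ∂μ, ∀ i, 0 ≤ x i)
    (hg : LaplaceIntegrable μ g) (hg0 : ∀ᵐ x ∂μ, 0 ≤ g x) (k : ℕ) (idx : Fin k → ι)
    {z : ι → ℝ} (hz : ∀ i, 0 < z i) :
    0 ≤ (-1 : ℝ) ^ k * iteratedFDerivWithin ℝ k (laplaceTransform μ g) {z | ∀ i, 0 < z i} z
      fun j => Pi.single (idx j) 1 := by
  induction k generalizing g with
  | zero =>
    simp only [pow_zero, one_mul, iteratedFDerivWithin_zero_apply]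
    refine integral_nonneg_of_ae ?_
    filter_upwards [hg0] with x hx
    exact mul_nonneg hx (Real.exp_pos _).le
  | succ k ih =>
    have hU := (isOpen_setOf_forall_pos (ι := ι)).uniqueDiffOn (𝕜 := ℝ)
    have hstep := ih (hg.coord_mul hμ (idx (Fin.last k)))
      (by filter_upwards [hμ, hg0] with x hx hgx using mul_nonneg (hx _) hgx)
      (fun j => idx j.castSucc)
    have hcd : ContDiffOn ℝ k (fderivWithin ℝ (laplaceTransform μ g) {z | ∀ i, 0 < z i})
        {z | ∀ i, 0 < z i} :=
      (contDiffOn_laplaceTransform hμ hg (k + 1)).fderivWithin hU (by simp)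
    have hpartial : Set.EqOn (fun w => fderivWithin ℝ (laplaceTransform μ g) {z | ∀ i, 0 < z i} w
          (Pi.single (idx (Fin.last k)) 1))
        (-laplaceTransform μ fun x => x (idx (Fin.last k)) * g x) {z | ∀ i, 0 < z i} := by
      intro w hw
      simp only
      rw [(hasFDerivAt_laplaceTransform hμ hg hw).hasFDerivWithinAt.fderivWithin (hU w hw)]
      simp [Pi.single_apply]
    rw [iteratedFDerivWithin_succ_apply_right hU hz,
      ← iteratedFDerivWithin_clm_apply_const_apply hU hcd le_rfl hz,
      iteratedFDerivWithin_congr hpartial hz, iteratedFDerivWithin_neg_apply hU hz, pow_succ]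
    have hinit : (Fin.init (α := fun _ => ι → ℝ) fun j => Pi.single (idx j) (1 : ℝ)) =
        fun j => Pi.single (idx j.castSucc) 1 := rfl
    simpa [hinit] using hstep

end Laplace

theorem setOf_forall_nonneg_ae_eq {ι : Type*} [Fintype ι] :
    ({x | ∀ i, 0 ≤ x i} : Set (ι → ℝ)) =ᵐ[volume] {x | ∀ i, 0 < x i} := by
  have h := (Measure.univ_pi_Ioi_ae_eq_Ici (μ := fun _ : ι => (volume : Measure ℝ))
    (f := fun _ => 0)).symm
  have h1 : ({x | ∀ i, 0 ≤ x i} : Set (ι → ℝ)) = Set.Ici fun _ => 0 := by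
    ext x; simp [Pi.le_def]
  have h2 : ({x | ∀ i, 0 < x i} : Set (ι → ℝ)) = Set.univ.pi fun _ => Set.Ioi 0 := by
    ext x; simp
  rw [h1, h2]
  exact h

theorem measurableSet_orthant_sublevel {ι : Type*} [Fintype ι] (z : ι → ℝ) (u : ℝ) :
    MeasurableSet {x : ι → ℝ | (∀ i, 0 < x i) ∧ ∑ i, z i * x i ≤ u} := by
  have hsum : Measurable fun x : ι → ℝ => ∑ i, z i * x i := by fun_prop
  exact isOpen_setOf_forall_pos.measurableSet.inter (measurableSet_le hsum measurable_const)

theorem lintegral_comp_smul {E : Type*} [NormedAddCommGroup E] [NormedSpace ℝ E]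
    [MeasurableSpace E] [BorelSpace E] [FiniteDimensional ℝ E] (μ : Measure E)
    [μ.IsAddHaarMeasure] {F : E → ENNReal} (hF : Measurable F) {r : ℝ} (hr : 0 < r) :
    ∫⁻ x, F x ∂μ = ENNReal.ofReal (r ^ Module.finrank ℝ E) * ∫⁻ x, F (r • x) ∂μ := by
  rw [← lintegral_map (g := fun x => r • x) hF (measurable_const_smul r),
    Measure.map_addHaar_smul μ hr.ne', lintegral_smul_measure, smul_eq_mul, ← mul_assoc,
    ← ENNReal.ofReal_mul (by positivity), abs_of_pos (by positivity),
    mul_inv_cancel₀ (by positivity), ENNReal.ofReal_one, one_mul]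

theorem lintegral_orthant_sublevel_of_homogeneous {n : ℕ} {t : ℝ} {f : (Fin n → ℝ) → ℝ}
    (hf_meas : Measurable f)
    (hf_homog : ∀ l : ℝ, 0 < l → ∀ x : Fin n → ℝ, (∀ i, 0 < x i) → f (l • x) = l ^ t * f x)
    (z : Fin n → ℝ) {u : ℝ} (hu : 0 < u) :
    ∫⁻ x in {x | (∀ i, 0 < x i) ∧ ∑ i, z i * x i ≤ u}, ENNReal.ofReal (f x) =
      ENNReal.ofReal (u ^ (n + t)) *
        ∫⁻ x in {x | (∀ i, 0 < x i) ∧ ∑ i, z i * x i ≤ 1}, ENNReal.ofReal (f x) := by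
  have hm := measurableSet_orthant_sublevel z
  rw [← lintegral_indicator (hm u), ← lintegral_indicator (hm 1),
    lintegral_comp_smul volume (hf_meas.ennreal_ofReal.indicator (hm u)) hu,
    Real.rpow_add hu, Real.rpow_natCast, ENNReal.ofReal_mul (by positivity), mul_assoc,
    Module.finrank_fin_fun]
  congr 1
  rw [← lintegral_const_mul _ (hf_meas.ennreal_ofReal.indicator (hm 1))]
  refine lintegral_congr fun x => ?_
  have hiff : u • x ∈ {x | (∀ i, 0 < x i) ∧ ∑ i, z i * x i ≤ u} ↔
      x ∈ {x | (∀ i, 0 < x i) ∧ ∑ i, z i * x i ≤ 1} := by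
    have hsum : ∑ i, z i * (u * x i) = u * ∑ i, z i * x i := by
      rw [mul_sum]
      exact sum_congr rfl fun i _ => by ring
    simp [hu, hsum]
  by_cases hx : x ∈ {x | (∀ i, 0 < x i) ∧ ∑ i, z i * x i ≤ 1}
  · rw [Set.indicator_of_mem (hiff.2 hx), Set.indicator_of_mem hx, hf_homog u hu x hx.1,
      ENNReal.ofReal_mul (by positivity)]
  · rw [Set.indicator_of_notMem (hiff.not.2 hx), Set.indicator_of_notMem hx, mul_zero]

theorem lintegral_exp_neg_Ici {s : ℝ} (hs : 0 ≤ s) :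
    ∫⁻ u in Set.Ioi 0, (Set.Ici s).indicator (fun u => ENNReal.ofReal (Real.exp (-u))) u =
      ENNReal.ofReal (Real.exp (-s)) := by
  rw [lintegral_indicator measurableSet_Ici, Measure.restrict_restrict measurableSet_Ici,
    ← integral_exp_neg_Ioi, ofReal_integral_eq_lintegral_ofReal (integrableOn_exp_neg_Ioi s)
      (Filter.Eventually.of_forall fun u => (Real.exp_pos _).le)]
  refine setLIntegral_congr ?_
  refine (Ioi_ae_eq_Ici.symm.inter (Filter.EventuallyEq.refl _ _)).trans ?_
  rw [Set.inter_eq_left.2 (Set.Ioi_subset_Ioi hs)]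
  exact Filter.EventuallyEq.rfl

theorem lintegral_Gamma {s : ℝ} (hs : 0 < s) :
    ∫⁻ u in Set.Ioi 0, ENNReal.ofReal (Real.exp (-u) * u ^ (s - 1)) =
      ENNReal.ofReal (Real.Gamma s) := by
  rw [Real.Gamma_eq_integral hs,
    ofReal_integral_eq_lintegral_ofReal (Real.GammaIntegral_convergent hs)]
  filter_upwards [ae_restrict_mem measurableSet_Ioi] with u hu
  exact mul_nonneg (Real.exp_pos _).le (Real.rpow_nonneg (le_of_lt hu) _)

theorem lintegral_mul_exp_neg_of_homogeneous {n : ℕ} {t : ℝ} (ht : -(n + 1 : ℝ) < t)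
    {f : (Fin n → ℝ) → ℝ} (hf_meas : Measurable f)
    (hf_homog : ∀ l : ℝ, 0 < l → ∀ x : Fin n → ℝ, (∀ i, 0 < x i) → f (l • x) = l ^ t * f x)
    {z : Fin n → ℝ} (hz : ∀ i, 0 < z i) :
    ∫⁻ x in {x | ∀ i, 0 < x i},
        ENNReal.ofReal (f x) * ENNReal.ofReal (Real.exp (-∑ i, z i * x i)) =
      ENNReal.ofReal (Real.Gamma (1 + n + t)) *
        ∫⁻ x in {x | (∀ i, 0 < x i) ∧ ∑ i, z i * x i ≤ 1}, ENNReal.ofReal (f x) := by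
  have hP : MeasurableSet {x : Fin n → ℝ | ∀ i, 0 < x i} := isOpen_setOf_forall_pos.measurableSet
  have hS : MeasurableSet {p : (Fin n → ℝ) × ℝ | ∑ i, z i * p.1 i ≤ p.2} :=
    measurableSet_le (by fun_prop) (by fun_prop)
  have hmeas : Measurable (Function.uncurry fun (x : Fin n → ℝ) (u : ℝ) =>
      ENNReal.ofReal (f x) * (Set.Ici (∑ i, z i * x i)).indicator
        (fun u => ENNReal.ofReal (Real.exp (-u))) u) := by
    refine (hf_meas.ennreal_ofReal.comp measurable_fst).mul ?_
    exact (Measurable.indicator (f := fun p : (Fin n → ℝ) × ℝ => ENNReal.ofReal (Real.exp (-p.2)))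
      (by fun_prop) hS)
  calc
    _ = ∫⁻ x in {x : Fin n → ℝ | ∀ i, 0 < x i}, ∫⁻ u in Set.Ioi 0, ENNReal.ofReal (f x) *
        (Set.Ici (∑ i, z i * x i)).indicator (fun u => ENNReal.ofReal (Real.exp (-u))) u := by
      refine setLIntegral_congr_fun hP fun x hx => ?_
      rw [lintegral_const_mul' _ _ ENNReal.ofReal_ne_top, lintegral_exp_neg_Ici
        (sum_nonneg fun i _ => (mul_pos (hz i) (hx i)).le)]
    _ = ∫⁻ u in Set.Ioi 0, ∫⁻ x in {x : Fin n → ℝ | ∀ i, 0 < x i}, ENNReal.ofReal (f x) *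
        (Set.Ici (∑ i, z i * x i)).indicator (fun u => ENNReal.ofReal (Real.exp (-u))) u :=
      lintegral_lintegral_swap hmeas.aemeasurable
    _ = ∫⁻ u in Set.Ioi 0, ENNReal.ofReal (Real.exp (-u) * u ^ (1 + n + t - 1)) *
        ∫⁻ x in {x | (∀ i, 0 < x i) ∧ ∑ i, z i * x i ≤ 1}, ENNReal.ofReal (f x) := by
      refine setLIntegral_congr_fun measurableSet_Ioi fun u hu => ?_
      have hexp : (1 + n + t - 1 : ℝ) = n + t := by ring
      rw [ENNReal.ofReal_mul (Real.exp_pos _).le, mul_assoc, hexp,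
        ← lintegral_orthant_sublevel_of_homogeneous hf_meas hf_homog z hu,
        ← lintegral_const_mul' _ _ ENNReal.ofReal_ne_top,
        ← lintegral_indicator hP, ← lintegral_indicator (measurableSet_orthant_sublevel z u)]
      refine lintegral_congr fun x => ?_
      by_cases h1 : ∀ i, 0 < x i <;> by_cases h2 : ∑ i, z i * x i ≤ u <;>
        simp [Set.indicator, h1, h2, mul_comm]
    _ = _ := by
      rw [lintegral_mul_const _ (by fun_prop), lintegral_Gamma (by linarith)]

theorem lintegral_orthant_sublevel_ne_top {n : ℕ} {t : ℝ} {f : (Fin n → ℝ) → ℝ}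
    (hf_meas : Measurable f)
    (hf_homog : ∀ l : ℝ, 0 < l → ∀ x : Fin n → ℝ, (∀ i, 0 < x i) → f (l • x) = l ^ t * f x)
    (hf_int : IntegrableOn f {x : Fin n → ℝ | (∀ i, 0 ≤ x i) ∧ ∑ i, x i ≤ 1})
    {z : Fin n → ℝ} (hz : ∀ i, 0 < z i) :
    ∫⁻ x in {x | (∀ i, 0 < x i) ∧ ∑ i, z i * x i ≤ 1}, ENNReal.ofReal (f x) ≠ ⊤ := by
  obtain ⟨c, hc, hcz⟩ := exists_pos_forall_le hz
  have hsub : {x : Fin n → ℝ | (∀ i, 0 < x i) ∧ ∑ i, z i * x i ≤ 1} ⊆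
      {x | (∀ i, 0 < x i) ∧ ∑ i, (1 : Fin n → ℝ) i * x i ≤ c⁻¹} := by
    rintro x ⟨hx, hzx⟩
    refine ⟨hx, ?_⟩
    rw [← one_div, le_div_iff₀' hc, mul_sum]
    refine (sum_le_sum fun i _ => ?_).trans hzx
    simpa using mul_le_mul_of_nonneg_right (hcz i) (hx i).le
  refine ((lintegral_mono_set hsub).trans_lt ?_).ne
  rw [lintegral_orthant_sublevel_of_homogeneous hf_meas hf_homog 1 (inv_pos.2 hc)]
  refine ENNReal.mul_lt_top ENNReal.ofReal_lt_top ?_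
  refine (lintegral_mono_set ?_).trans_lt hf_int.lintegral_lt_top
  rintro x ⟨hx, h1⟩
  exact ⟨fun i => (hx i).le, by simpa using h1⟩

theorem laplace_transform_completely_monotone (n : ℕ) (t : ℝ)
    (f : (Fin n → ℝ) → ℝ) (hf_meas : Measurable f)
    (hf_nonneg : ∀ x : Fin n → ℝ, (∀ i, 0 < x i) → 0 ≤ f x)
    (hf_homog : ∀ (l : ℝ), 0 < l → ∀ x : Fin n → ℝ, (∀ i, 0 < x i) →
      f (l • x) = l ^ t * f x)
    (ht : -(n + 1 : ℝ) < t)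
    (hf_int : IntegrableOn f {x : Fin n → ℝ | (∀ i, 0 ≤ x i) ∧ ∑ i, x i ≤ 1})
    (hf : (Fin n → ℝ) → ℝ)
    (hhf : ∀ z : Fin n → ℝ, hf z =
      Real.Gamma (1 + n + t) *
        ∫ x in {x : Fin n → ℝ | (∀ i, 0 ≤ x i) ∧ ∑ i, z i * x i ≤ 1}, f x) :
    (∀ z : Fin n → ℝ, (∀ i, 0 < z i) →
        hf z = ∫ x in {x : Fin n → ℝ | ∀ i, 0 ≤ x i},
          f x * Real.exp (-∑ i, z i * x i)) ∧
      ∀ (k : ℕ) (idx : Fin k → Fin n) (z : Fin n → ℝ), (∀ i, 0 < z i) →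
        0 ≤ (-1 : ℝ) ^ k *
          iteratedFDeriv ℝ k hf z (fun j => Pi.single (idx j) 1) := by
  have hP : MeasurableSet {x : Fin n → ℝ | ∀ i, 0 < x i} := isOpen_setOf_forall_pos.measurableSet
  have hnonneg : ∀ᵐ x ∂volume.restrict {x : Fin n → ℝ | ∀ i, 0 ≤ x i}, 0 ≤ f x := by
    rw [Measure.restrict_congr_set setOf_forall_nonneg_ae_eq]
    filter_upwards [ae_restrict_mem hP] with x hx using hf_nonneg x hx
  have hlaplace_nonneg : ∀ z : Fin n → ℝ,
      ∀ᵐ x ∂volume.restrict {x : Fin n → ℝ | ∀ i, 0 ≤ x i},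
        0 ≤ f x * Real.exp (-∑ i, z i * x i) := fun z => by
    filter_upwards [hnonneg] with x hx using mul_nonneg hx (Real.exp_pos _).le
  have hmeas : ∀ z : Fin n → ℝ, Measurable fun x => f x * Real.exp (-∑ i, z i * x i) :=
    fun z => by fun_prop
  have hlintegral : ∀ z : Fin n → ℝ, (∀ i, 0 < z i) →
      ∫⁻ x in {x | ∀ i, 0 ≤ x i}, ENNReal.ofReal (f x * Real.exp (-∑ i, z i * x i)) =
        ENNReal.ofReal (Real.Gamma (1 + n + t)) *
          ∫⁻ x in {x | (∀ i, 0 < x i) ∧ ∑ i, z i * x i ≤ 1}, ENNReal.ofReal (f x) := by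
    intro z hz
    rw [← lintegral_mul_exp_neg_of_homogeneous ht hf_meas hf_homog hz,
      setLIntegral_congr setOf_forall_nonneg_ae_eq]
    exact lintegral_congr fun x => ENNReal.ofReal_mul' (Real.exp_pos _).le
  have hsublevel : ∀ z : Fin n → ℝ,
      ∫ x in {x : Fin n → ℝ | (∀ i, 0 ≤ x i) ∧ ∑ i, z i * x i ≤ 1}, f x =
        (∫⁻ x in {x | (∀ i, 0 < x i) ∧ ∑ i, z i * x i ≤ 1}, ENNReal.ofReal (f x)).toReal := by
    intro z
    have hset : ({x | (∀ i, 0 ≤ x i) ∧ ∑ i, z i * x i ≤ 1} : Set (Fin n → ℝ)) =ᵐ[volume]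
        {x | (∀ i, 0 < x i) ∧ ∑ i, z i * x i ≤ 1} :=
      setOf_forall_nonneg_ae_eq.inter (Filter.EventuallyEq.refl _ {x : Fin n → ℝ | ∑ i, z i * x i ≤ 1})
    rw [setIntegral_congr_set hset,
      integral_eq_lintegral_of_nonneg_ae _ hf_meas.aestronglyMeasurable]
    filter_upwards [ae_restrict_mem (measurableSet_orthant_sublevel z 1)] with x hx
      using hf_nonneg x hx.1
  have heq : ∀ z : Fin n → ℝ, (∀ i, 0 < z i) →
      hf z = ∫ x in {x : Fin n → ℝ | ∀ i, 0 ≤ x i}, f x * Real.exp (-∑ i, z i * x i) := by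
    intro z hz
    rw [hhf, hsublevel, integral_eq_lintegral_of_nonneg_ae (hlaplace_nonneg z)
      (hmeas z).aestronglyMeasurable, hlintegral z hz, ENNReal.toReal_mul,
      ENNReal.toReal_ofReal (Real.Gamma_pos_of_pos (by linarith)).le]
  refine ⟨heq, fun k idx z hz => ?_⟩
  have hinteg : LaplaceIntegrable (volume.restrict {x : Fin n → ℝ | ∀ i, 0 ≤ x i}) f := by
    intro w hw
    refine ⟨(hmeas w).aestronglyMeasurable, ?_⟩
    rw [hasFiniteIntegral_iff_ofReal (hlaplace_nonneg w), hlintegral w hw]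
    exact ENNReal.mul_lt_top ENNReal.ofReal_lt_top
      (lintegral_orthant_sublevel_ne_top hf_meas hf_homog hf_int hw).lt_top
  have hsupp : ∀ᵐ x ∂volume.restrict {x : Fin n → ℝ | ∀ i, 0 ≤ x i}, ∀ i, 0 ≤ x i := by
    rw [Measure.restrict_congr_set setOf_forall_nonneg_ae_eq]
    filter_upwards [ae_restrict_mem hP] with x hx i using (hx i).le
  have hzU : z ∈ {z : Fin n → ℝ | ∀ i, 0 < z i} := hz
  have heqOn : Set.EqOn hf (laplaceTransform (volume.restrict {x | ∀ i, 0 ≤ x i}) f)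
      {z | ∀ i, 0 < z i} := heq
  rw [← iteratedFDerivWithin_of_isOpen k isOpen_setOf_forall_pos hzU,
    iteratedFDerivWithin_congr heqOn hzU]
  exact iteratedFDerivWithin_laplaceTransform_nonneg hsupp hinteg hnonneg k idx hz
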